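/- For any Borel probability measure P on ℝ^d, the map (z, δ) ↦ D_δ(z|P) is jointly continuous on ℝ^d × (0,∞). -/

import Mathlib

open MeasureTheory RealInnerProductSpace
open scoped ENNReal

abbrev Ed (d : ℕ) := EuclideanSpace ℝ (Fin d)

/-- 1-Wasserstein distance between Borel measures on `ℝ^d`. -/
noncomputable def wassersteinDist {d : ℕ} (P Q : Measure (Ed d)) : ℝ≥0∞ :=
  ⨅ (π : Measure (Ed d × Ed d)) (_ : π.map Prod.fst = P) (_ : π.map Prod.snd = Q),
    ∫⁻ p, ENNReal.ofReal ‖p.1 - p.2‖ ∂π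

/-- Worst-case probability of a set over the Wasserstein ball of radius `δ` around `P`. -/
noncomputable def supProb {d : ℕ} (δ : ℝ) (P : Measure (Ed d)) (A : Set (Ed d)) : ℝ :=
  sSup {v : ℝ | ∃ Q : Measure (Ed d), IsProbabilityMeasure Q ∧
    wassersteinDist Q P ≤ ENNReal.ofReal δ ∧ v = (Q A).toReal}

/-- Distributionally robust halfspace depth. -/
noncomputable def robustDepth {d : ℕ} (δ : ℝ) (z : Ed d) (P : Measure (Ed d)) : ℝ :=
  sInf {v : ℝ | ∃ u : Ed d, ‖u‖ = 1 ∧ v = supProb δ P {x | 0 ≤ ⟪u, x - z⟫}}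

theorem wassersteinDist_le_lintegral {d : ℕ} (π : Measure (Ed d × Ed d)) :
    wassersteinDist (π.map Prod.fst) (π.map Prod.snd) ≤ ∫⁻ p, ENNReal.ofReal ‖p.1 - p.2‖ ∂π :=
  iInf_le_of_le π <| iInf_le_of_le rfl <| iInf_le_of_le rfl le_rfl

theorem wassersteinDist_map_add_right_le {d : ℕ} (Q P : Measure (Ed d)) [IsProbabilityMeasure Q]
    (w : Ed d) :
    wassersteinDist (Q.map (· + w)) P ≤ wassersteinDist Q P + ENNReal.ofReal ‖w‖ := by
  conv_rhs => unfold wassersteinDist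
  simp only [ENNReal.iInf_add]
  refine le_iInf fun π => le_iInf fun hQ => le_iInf fun hP => ?_
  have hπ : π Set.univ = 1 := by
    rw [← measure_univ (μ := Q), ← hQ, Measure.map_apply measurable_fst .univ, Set.preimage_univ]
  have hf : Measurable fun p : Ed d × Ed d => (p.1 + w, p.2) := by fun_prop
  have h := wassersteinDist_le_lintegral (π.map fun p => (p.1 + w, p.2))
  rw [Measure.map_map measurable_fst hf, Measure.map_map measurable_snd hf,
    lintegral_map (by fun_prop) hf] at h
  have h₁ : π.map (Prod.fst ∘ fun p : Ed d × Ed d => (p.1 + w, p.2)) = Q.map (· + w) := by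
    rw [← hQ, Measure.map_map (measurable_add_const w) measurable_fst]; rfl
  have h₂ : π.map (Prod.snd ∘ fun p : Ed d × Ed d => (p.1 + w, p.2)) = P := hP
  rw [h₁, h₂] at h
  calc wassersteinDist (Q.map (· + w)) P
      ≤ ∫⁻ p, ENNReal.ofReal ‖p.1 + w - p.2‖ ∂π := h
    _ ≤ ∫⁻ p, (ENNReal.ofReal ‖p.1 - p.2‖ + ENNReal.ofReal ‖w‖) ∂π := by
        refine lintegral_mono fun p => ?_
        rw [← ENNReal.ofReal_add (norm_nonneg _) (norm_nonneg _)]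
        refine ENNReal.ofReal_le_ofReal ?_
        rw [add_sub_right_comm]
        exact norm_add_le _ _
    _ = ∫⁻ p, ENNReal.ofReal ‖p.1 - p.2‖ ∂π + ENNReal.ofReal ‖w‖ := by
        rw [lintegral_add_right _ measurable_const, lintegral_const, hπ, mul_one]

theorem wassersteinDist_mixture_le {d : ℕ} (Q P : Measure (Ed d)) {s r : ℝ≥0∞}
    (hsr : s + r = 1) (hr : r ≠ 0) :
    wassersteinDist (s • P + r • Q) P ≤ r * wassersteinDist Q P := by
  have hr' : r ≠ ∞ := ne_top_of_le_ne_top ENNReal.one_ne_top (hsr ▸ le_add_self)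
  conv_rhs => unfold wassersteinDist
  simp only [ENNReal.mul_iInf_of_ne hr hr']
  refine le_iInf fun π => le_iInf fun hQ => le_iInf fun hP => ?_
  have hf : Measurable fun x : Ed d => (x, x) := by fun_prop
  have h := wassersteinDist_le_lintegral (s • P.map (fun x => (x, x)) + r • π)
  rw [Measure.map_add _ _ measurable_fst, Measure.map_add _ _ measurable_snd, Measure.map_smul,
    Measure.map_smul, Measure.map_smul, Measure.map_smul, Measure.map_map measurable_fst hf,
    Measure.map_map measurable_snd hf, hQ, hP, lintegral_add_measure, lintegral_smul_measure,
    lintegral_smul_measure, lintegral_map (by fun_prop) hf] at h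
  have h₁ : P.map (Prod.fst ∘ fun x : Ed d => (x, x)) = P := Measure.map_id
  have h₂ : P.map (Prod.snd ∘ fun x : Ed d => (x, x)) = P := Measure.map_id
  rw [h₁, h₂, ← add_smul, hsr, one_smul] at h
  simpa using h

theorem le_supProb {d : ℕ} {δ : ℝ} {P Q : Measure (Ed d)} [IsProbabilityMeasure Q]
    (h : wassersteinDist Q P ≤ ENNReal.ofReal δ) (A : Set (Ed d)) :
    (Q A).toReal ≤ supProb δ P A := by
  refine le_csSup ⟨1, ?_⟩ ⟨Q, inferInstance, h, rfl⟩
  rintro _ ⟨R, hR, -, rfl⟩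
  exact measureReal_le_one

theorem supProb_nonneg {d : ℕ} (δ : ℝ) (P : Measure (Ed d)) (A : Set (Ed d)) :
    0 ≤ supProb δ P A := by
  refine Real.sSup_nonneg ?_
  rintro _ ⟨Q, -, -, rfl⟩
  exact ENNReal.toReal_nonneg

theorem supProb_halfspace_le {d : ℕ} (P : Measure (Ed d)) [IsProbabilityMeasure P] (u z z' : Ed d)
    {a b : ℝ} (ha : 0 < a) (hb : 0 ≤ b) :
    supProb b P {x | 0 ≤ ⟪u, x - z'⟫} ≤
      max 1 ((b + ‖z' - z‖) / a) * supProb a P {x | 0 ≤ ⟪u, x - z⟫} := by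
  set M := max 1 ((b + ‖z' - z‖) / a)
  have hM1 : 1 ≤ M := le_max_left _ _
  have hM0 : 0 < M := one_pos.trans_le hM1
  refine Real.sSup_le ?_ (mul_nonneg hM0.le (supProb_nonneg _ _ _))
  rintro _ ⟨Q, hQ, hQP, rfl⟩
  let T := Q.map (· + (z - z'))
  let r := ENNReal.ofReal M⁻¹
  have hr : r ≠ 0 := (ENNReal.ofReal_pos.2 (inv_pos.2 hM0)).ne'
  have hr1 : r ≤ 1 := ENNReal.ofReal_le_one.2 (inv_le_one_of_one_le₀ hM1)
  have hsr : 1 - r + r = 1 := tsub_add_cancel_of_le hr1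
  have : IsProbabilityMeasure T := Measure.isProbabilityMeasure_map (by fun_prop)
  have : IsProbabilityMeasure ((1 - r) • P + r • T) := ⟨by simp [hsr]⟩
  have hdist : wassersteinDist ((1 - r) • P + r • T) P ≤ ENNReal.ofReal a :=
    calc wassersteinDist ((1 - r) • P + r • T) P
        ≤ r * (ENNReal.ofReal b + ENNReal.ofReal ‖z - z'‖) :=
          (wassersteinDist_mixture_le T P hsr hr).trans <| by
            gcongr
            exact (wassersteinDist_map_add_right_le Q P _).trans (by gcongr)
      _ = ENNReal.ofReal (M⁻¹ * (b + ‖z' - z‖)) := by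
          rw [← ENNReal.ofReal_add hb (norm_nonneg _), ← ENNReal.ofReal_mul (inv_nonneg.2 hM0.le),
            norm_sub_rev]
      _ ≤ ENNReal.ofReal a := by
          refine ENNReal.ofReal_le_ofReal ?_
          rw [inv_mul_le_iff₀ hM0, ← div_le_iff₀ ha]
          exact le_max_right _ _
  have hmeas : MeasurableSet {x : Ed d | 0 ≤ ⟪u, x - z⟫} :=
    (isClosed_le (by fun_prop) (by fun_prop)).measurableSet
  have hT : T {x | 0 ≤ ⟪u, x - z⟫} = Q {x | 0 ≤ ⟪u, x - z'⟫} := by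
    rw [Measure.map_apply (by fun_prop) hmeas]
    congr 1
    ext x
    simp only [Set.mem_preimage, Set.mem_ofPred_eq]
    rw [show x + (z - z') - z = x - z' by abel]
  rw [← inv_mul_le_iff₀ hM0]
  refine le_trans ?_ (le_supProb hdist _)
  rw [← hT, ← ENNReal.toReal_ofReal (inv_nonneg.2 hM0.le), ← ENNReal.toReal_mul]
  exact ENNReal.toReal_mono (measure_ne_top _ _) le_add_self

theorem robustDepth_le {d : ℕ} (P : Measure (Ed d)) [IsProbabilityMeasure P] (z z' : Ed d)
    {a b : ℝ} (ha : 0 < a) (hb : 0 ≤ b) :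
    robustDepth b z' P ≤ max 1 ((b + ‖z' - z‖) / a) * robustDepth a z P := by
  have hM0 : 0 < max 1 ((b + ‖z' - z‖) / a) := one_pos.trans_le (le_max_left _ _)
  rw [← inv_mul_le_iff₀ hM0]
  by_cases hu : ∃ u : Ed d, ‖u‖ = 1
  · obtain ⟨u₀, hu₀⟩ := hu
    refine le_csInf ⟨_, u₀, hu₀, rfl⟩ ?_
    rintro _ ⟨u, hu, rfl⟩
    rw [inv_mul_le_iff₀ hM0]
    refine le_trans (csInf_le ⟨0, ?_⟩ ⟨u, hu, rfl⟩) (supProb_halfspace_le P u z z' ha hb)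
    rintro _ ⟨v, -, rfl⟩
    exact supProb_nonneg _ _ _
  · have h (δ : ℝ) (y : Ed d) : robustDepth δ y P = 0 := by
      unfold robustDepth
      convert Real.sInf_empty
      ext v
      simp only [Set.mem_ofPred_eq, Set.mem_empty_iff_false, iff_false]
      exact fun ⟨u, h, _⟩ => hu ⟨u, h⟩
    simp [h]

/-- **Joint continuity (P5).** `(z, δ) ↦ D_δ(z|P)` is continuous on `ℝ^d × (0,∞)`. -/
theorem robustDepth_continuousOn {d : ℕ} (P : Measure (Ed d)) [IsProbabilityMeasure P] :
    ContinuousOn (fun q : Ed d × ℝ => robustDepth q.2 q.1 P)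
      (Set.univ ×ˢ Set.Ioi (0:ℝ)) := by
  rintro ⟨z, δ⟩ ⟨-, hδ : 0 < δ⟩
  refine ContinuousAt.continuousWithinAt ?_
  have hpos : ∀ᶠ q : Ed d × ℝ in nhds (z, δ), 0 < q.2 :=
    continuousAt_snd.eventually (lt_mem_nhds hδ)
  have hupper : ContinuousAt (fun q : Ed d × ℝ =>
      max 1 ((q.2 + ‖q.1 - z‖) / δ) * robustDepth δ z P) (z, δ) := by
    fun_prop
  have hlower : ContinuousAt (fun q : Ed d × ℝ =>
      (max 1 ((δ + ‖z - q.1‖) / q.2))⁻¹ * robustDepth δ z P) (z, δ) := by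
    refine ContinuousAt.mul (ContinuousAt.inv₀ (continuousAt_const.max
      (ContinuousAt.div (by fun_prop) (by fun_prop) hδ.ne')) ?_) continuousAt_const
    exact (one_pos.trans_le (le_max_left _ _)).ne'
  have hupper' := hupper.tendsto
  have hlower' := hlower.tendsto
  simp only [sub_self, norm_zero, add_zero, div_self hδ.ne', max_self, inv_one, one_mul]
    at hupper' hlower'
  refine tendsto_of_tendsto_of_tendsto_of_le_of_le' hlower' hupper' ?_ ?_
  · filter_upwards [hpos] with q hq
    rw [inv_mul_le_iff₀ (one_pos.trans_le (le_max_left _ _))]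
    exact robustDepth_le P q.1 z hq hδ.le
  · filter_upwards [hpos] with q hq
    exact robustDepth_le P z q.1 hδ hq.le
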